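/- Let V be a real vector space, ι an index type, and (Vᵢ)_{i ∈ ι} a family of linear subspaces of V. Let R : V × V × V × V → ℝ be a multilinear map satisfying, for all x,y,z,v ∈ V: (i) R(x,y,z,v) = −R(y,x,z,v); (ii) R(x,y,z,v) = −R(x,y,v,z); (iii) R(x,y,z,v) + R(y,z,x,v) + R(z,x,y,v) = 0. Assume that R(x,y,z,w) = 0 for all x,y ∈ V whenever z ∈ Vᵢ and w ∈ Vⱼ with i ≠ j. Then for all indices i,j,k,l and all x ∈ Vᵢ, y ∈ Vⱼ, z ∈ V_k, w ∈ V_l, one has R(x,y,z,w) = 0 unless i = j = k = l. -/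

import Mathlib

/-- A curvature-like tensor is symmetric under exchange of its two pairs of arguments. -/
theorem curvature_pair_symm {V : Type*} (R : V → V → V → V → ℝ)
    (hskew₁ : ∀ x y z v : V, R x y z v = -R y x z v)
    (hskew₂ : ∀ x y z v : V, R x y z v = -R x y v z)
    (hbianchi : ∀ x y z v : V, R x y z v + R y z x v + R z x y v = 0) (x y z w : V) :
    R x y z w = R z w x y := by
  linarith [hbianchi x y z w, hbianchi y z w x, hbianchi z w x y, hbianchi w x y z,
    hskew₂ x y z w, hskew₂ y z x w, hskew₂ z x y w, hskew₂ z w x y, hskew₂ w y z x,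
    hskew₁ w y x z, hskew₁ x z w y, hskew₂ w x y z]

/-- If a curvature-like tensor preserves each member of a family of subspaces `Vs i`
(in the sense that `R(x,y,z,w) = 0` whenever `z ∈ Vs i`, `w ∈ Vs j` with `i ≠ j`),
then `R(x,y,z,w) = 0` for `x ∈ Vs i`, `y ∈ Vs j`, `z ∈ Vs k`, `w ∈ Vs l` unless
`i = j = k = l`. -/
theorem curvature_vanishing_off_diagonal
    {V : Type*} [AddCommGroup V] [Module ℝ V] {ι : Type*}
    (Vs : ι → Submodule ℝ V)
    (R : V →ₗ[ℝ] V →ₗ[ℝ] V →ₗ[ℝ] V →ₗ[ℝ] ℝ)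
    (hskew₁ : ∀ x y z v : V, R x y z v = -R y x z v)
    (hskew₂ : ∀ x y z v : V, R x y z v = -R x y v z)
    (hbianchi : ∀ x y z v : V, R x y z v + R y z x v + R z x y v = 0)
    (hpres : ∀ i j : ι, i ≠ j → ∀ x y z w : V, z ∈ Vs i → w ∈ Vs j → R x y z w = 0) :
    ∀ (i j k l : ι) (x y z w : V), x ∈ Vs i → y ∈ Vs j → z ∈ Vs k → w ∈ Vs l →
      ¬(i = j ∧ j = k ∧ k = l) → R x y z w = 0 := by
  intro i j k l x y z w hx hy hz hw hne
  by_cases hkl : k = l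
  · by_cases hij : i = j
    · subst hkl hij
      have hik : i ≠ k := fun h => hne ⟨rfl, h, rfl⟩
      linarith [hbianchi x y z w, hpres i k hik y z x w hx hw, hpres i k hik z x y w hy hw]
    · rw [curvature_pair_symm (fun x y z w => R x y z w) hskew₁ hskew₂ hbianchi x y z w]
      exact hpres i j hij z w x y hx hy
  · exact hpres k l hkl x y z w hz hw
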